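/- Assume the Littlewood conjecture: for all α, β ∈ ℝ, liminf_{n→∞} n‖nα‖‖nβ‖ = 0, where n ranges over positive integers. Then for all integers k > d ≥ 1 with (k,d) ≠ (2,1), there is no k to d cubical cut and project set which is LR with respect to ℛ_d. -/

import Mathlib

noncomputable section

open MeasureTheory Set Filter

/-- The distance from a real number to the nearest integer. -/
def distInt (x : ℝ) : ℝ := |x - round x|

/-- The real vector in `ℝ^k` corresponding to an integer vector. -/
def intVec {k : ℕ} (n : Fin k → ℤ) : Fin k → ℝ := fun i => (n i : ℝ)

/-- The embedding of `ℝ^d` into `ℝ^k` as the span of the first `d` coordinates. -/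
def emb (k d : ℕ) (x : Fin d → ℝ) : Fin k → ℝ :=
  fun i => if h : (i : ℕ) < d then x ⟨i, h⟩ else 0

/-- A `k` to `d` cut and project scheme: a totally irrational `d`-dimensional subspace
`E ⊆ ℝ^k`, the projection `proj = π` onto `E` along a complementary subspace `F_π`
(injective on `ℤ^k`), the projection `rho = ρ` onto `E` with respect to the decomposition
`ℝ^k = E + F_ρ` where `F_ρ = {0} × ℝ^{k-d}`, a window `W ⊆ F_ρ`, and a point `s`
(a representative of a point of `ℝ^k/ℤ^k`). -/
structure CPS (k d : ℕ) where
  E : Submodule ℝ (Fin k → ℝ)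
  rank_E : Module.finrank ℝ E = d
  /-- `E` is totally irrational: its image in `ℝ^k/ℤ^k` is dense,
  equivalently `E + ℤ^k` is dense in `ℝ^k`. -/
  totallyIrrational : Dense {x : Fin k → ℝ | ∃ e ∈ E, ∃ n : Fin k → ℤ, x = e + intVec n}
  /-- `π`, the projection onto `E` along a complementary subspace `F_π = ker proj`. -/
  proj : (Fin k → ℝ) →ₗ[ℝ] (Fin k → ℝ)
  proj_mem : ∀ x, proj x ∈ E
  proj_id : ∀ x ∈ E, proj x = x
  /-- `π` is injective on `ℤ^k`. -/
  proj_inj : ∀ m n : Fin k → ℤ, proj (intVec m) = proj (intVec n) → m = n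
  /-- `ρ`, the projection onto `E` with respect to the decomposition `ℝ^k = E + F_ρ`. -/
  rho : (Fin k → ℝ) →ₗ[ℝ] (Fin k → ℝ)
  rho_mem : ∀ x, rho x ∈ E
  /-- `x - ρ(x) ∈ F_ρ = {0} × ℝ^{k-d}`; in particular `ρ* = id - ρ` maps into `F_ρ`. -/
  rho_decomp : ∀ (x : Fin k → ℝ) (i : Fin k), (i : ℕ) < d → x i - rho x i = 0
  /-- The window `W ⊆ F_ρ`. -/
  window : Set (Fin k → ℝ)
  window_sub : ∀ x ∈ window, ∀ i : Fin k, (i : ℕ) < d → x i = 0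
  /-- A representative of the point `s ∈ ℝ^k/ℤ^k`. -/
  s : Fin k → ℝ

namespace CPS

variable {k d : ℕ} (𝒟 : CPS k d)

/-- `ρ* : ℝ^k → F_ρ`, the projection onto `F_ρ` along `E`. -/
def rhoStar (x : Fin k → ℝ) : Fin k → ℝ := x - 𝒟.rho x

/-- The strip `S = W + E`. -/
def strip : Set (Fin k → ℝ) := {z | ∃ w ∈ 𝒟.window, ∃ e ∈ (𝒟.E : Set (Fin k → ℝ)), z = w + e}

/-- The cut and project set `Y = π(S ∩ (ℤ^k + s))`. -/
def Y : Set (Fin k → ℝ) :=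
  𝒟.proj '' (𝒟.strip ∩ {z | ∃ n : Fin k → ℤ, z = intVec n + 𝒟.s})

/-- `s` is regular: `ℤ^k + s` does not meet the boundary of the strip. -/
def Regular : Prop := ∀ n : Fin k → ℤ, intVec n + 𝒟.s ∉ frontier 𝒟.strip

/-- `Y` is aperiodic: its group of periods is trivial. -/
def Aperiodic : Prop := ∀ x ∈ (𝒟.E : Set (Fin k → ℝ)),
  {z | ∃ y ∈ 𝒟.Y, z = y + x} = 𝒟.Y → x = 0

/-- The window is the cubical window `{Σ_{i=d+1}^k t_i e_i : 0 ≤ t_i < 1}`. -/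
def IsCubical : Prop :=
  𝒟.window = {x : Fin k → ℝ | ∀ i : Fin k,
    if (i : ℕ) < d then x i = 0 else 0 ≤ x i ∧ x i < 1}

/-- The window is the canonical window `ρ*([0,1]^k)`. -/
def IsCanonical : Prop :=
  𝒟.window = 𝒟.rhoStar '' {x : Fin k → ℝ | ∀ i, x i ∈ Icc (0 : ℝ) 1}

/-- `Y` is a cubical cut and project set: totally irrational (a field of `CPS`),
regular, aperiodic, and formed with the cubical window. -/
def IsCubicalCPSet : Prop := 𝒟.IsCubical ∧ 𝒟.Regular ∧ 𝒟.Aperiodic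

/-- `Y` is a canonical cut and project set. -/
def IsCanonicalCPSet : Prop := 𝒟.IsCanonical ∧ 𝒟.Regular ∧ 𝒟.Aperiodic

/-- For `y ∈ Y`, the (unique, by injectivity of `π` on `ℤ^k`) integer vector `ỹ`
with `ỹ + s ∈ S` and `π(ỹ + s) = y`. -/
def intRep (y : Fin k → ℝ) : Fin k → ℤ :=
  Classical.epsilon fun n : Fin k → ℤ =>
    intVec n + 𝒟.s ∈ 𝒟.strip ∧ 𝒟.proj (intVec n + 𝒟.s) = y

/-- The patch of shape `Ω` at `y`: `P(y,Ω) = {y' ∈ Y : ρ(ỹ' - ỹ) ∈ ρ(Ω)}`,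
where `Ω ⊆ ℝ^d` is viewed inside `⟨e₁,…,e_d⟩_ℝ ⊆ ℝ^k`. -/
def patch (Ω : Set (Fin d → ℝ)) (y : Fin k → ℝ) : Set (Fin k → ℝ) :=
  {y' | y' ∈ 𝒟.Y ∧
    𝒟.rho (intVec (𝒟.intRep y') - intVec (𝒟.intRep y)) ∈ 𝒟.rho '' (emb k d '' Ω)}

/-- Two patches of shape `Ω` are equivalent if they agree up to the translation
taking one distinguished point to the other. -/
def PatchEquiv (Ω : Set (Fin d → ℝ)) (y₁ y₂ : Fin k → ℝ) : Prop :=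
  𝒟.patch Ω y₁ = {z | ∃ w ∈ 𝒟.patch Ω y₂, z = w + (y₁ - y₂)}

/-- The pattern (equivalence class) of the patch of shape `Ω` at `y` occurs in the
region `R ⊆ E`: some point `y' ∈ Y ∩ R` has patch equivalent to that at `y`. -/
def OccursIn (Ω : Set (Fin d → ℝ)) (y : Fin k → ℝ) (R : Set (Fin k → ℝ)) : Prop :=
  ∃ y' ∈ 𝒟.Y ∩ R, 𝒟.PatchEquiv Ω y' y

/-- `Y` is linearly repetitive with respect to a collection `𝒜` of shapes in `ℝ^d`:
there is `C > 0` such that for every `Ω ∈ 𝒜`, every pattern of shape `Ω` occurring in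
`Y` occurs in every ball in `E` of volume `C·|Ω|` (balls in `E` being images under the
identification `ρ ∘ emb : ℝ^d ≅ E` of balls in `ℝ^d`). -/
def IsLR (𝒜 : Set (Set (Fin d → ℝ))) : Prop :=
  ∃ C > (0 : ℝ), ∀ Ω ∈ 𝒜, ∀ y ∈ 𝒟.Y, ∀ (x : Fin d → ℝ) (r : ℝ),
    volume (Metric.closedBall x r) = ENNReal.ofReal C * volume Ω →
    𝒟.OccursIn Ω y (𝒟.rho '' (emb k d '' Metric.closedBall x r))

/-- `Y` is `LR_Ω` with respect to a collection `𝒜` of shapes in `ℝ^d`: there is `C > 0`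
such that for every `Ω ∈ 𝒜`, every pattern of shape `Ω` occurring in `Y` occurs in every
translate of `C·Ω`. -/
def IsLROmega (𝒜 : Set (Set (Fin d → ℝ))) : Prop :=
  ∃ C > (0 : ℝ), ∀ Ω ∈ 𝒜, ∀ y ∈ 𝒟.Y, ∀ x : Fin d → ℝ,
    𝒟.OccursIn Ω y (𝒟.rho '' (emb k d '' {z | ∃ w ∈ Ω, z = x + C • w}))

end CPS

/-- `ℛ_d`: aligned rectangles in `ℝ^d` with integer vertices and nonempty interior. -/
def RdCollection (d : ℕ) : Set (Set (Fin d → ℝ)) :=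
  {Ω | ∃ a b : Fin d → ℤ, (∀ i, a i < b i) ∧
    Ω = {x : Fin d → ℝ | ∀ i, (a i : ℝ) ≤ x i ∧ x i ≤ (b i : ℝ)}}

/-- `𝒞_d`: convex polytopes in `ℝ^d` with vertices in `ℤ^d` and nonempty interior. -/
def CdCollection (d : ℕ) : Set (Set (Fin d → ℝ)) :=
  {Ω | (∃ V : Finset (Fin d → ℤ),
      Ω = convexHull ℝ ((fun n : Fin d → ℤ => intVec n) '' (V : Set (Fin d → ℤ)))) ∧
    (interior Ω).Nonempty}

namespace CPS

variable {k d : ℕ} (𝒟 : CPS k d)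

lemma intVec_add (m n : Fin k → ℤ) : intVec (m + n) = intVec m + intVec n := by
  funext i; simp [intVec]

lemma intVec_sub (m n : Fin k → ℤ) : intVec (m - n) = intVec m - intVec n := by
  funext i; simp [intVec]

lemma emb_add (x y : Fin d → ℝ) : emb k d (x + y) = emb k d x + emb k d y := by
  funext i; simp only [emb, Pi.add_apply]; split_ifs <;> simp

lemma emb_smul (c : ℝ) (x : Fin d → ℝ) : emb k d (c • x) = c • emb k d x := by
  funext i; simp only [emb, Pi.smul_apply]; split_ifs <;> simp

lemma E_zero (hkd : d < k) {e : Fin k → ℝ} (he : e ∈ 𝒟.E)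
    (h0 : ∀ i : Fin k, (i : ℕ) < d → e i = 0) : e = 0 := by
  let R : 𝒟.E →ₗ[ℝ] (Fin d → ℝ) :=
    { toFun := fun e i => (e : Fin k → ℝ) (Fin.castLE hkd.le i)
      map_add' := by intros; rfl
      map_smul' := by intros; rfl }
  have hs : Function.Surjective R := by
    intro x
    refine ⟨⟨𝒟.rho (emb k d x), 𝒟.rho_mem _⟩, ?_⟩
    funext i
    have := 𝒟.rho_decomp (emb k d x) (Fin.castLE hkd.le i) (by simp)
    have h2 : emb k d x (Fin.castLE hkd.le i) = x i := by simp [emb]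
    show 𝒟.rho (emb k d x) (Fin.castLE hkd.le i) = x i
    linarith
  have hi : Function.Injective R :=
    (LinearMap.injective_iff_surjective_of_finrank_eq_finrank
      (by rw [𝒟.rank_E]; simp)).2 hs
  have : (⟨e, he⟩ : 𝒟.E) = 0 := by
    apply hi
    rw [map_zero]
    funext i
    exact h0 _ (by simp)
  exact congrArg Subtype.val this

lemma rho_E (hkd : d < k) {e : Fin k → ℝ} (he : e ∈ 𝒟.E) : 𝒟.rho e = e := by
  have := 𝒟.E_zero hkd (𝒟.E.sub_mem he (𝒟.rho_mem e)) (fun i hi => 𝒟.rho_decomp e i hi)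
  exact (sub_eq_zero.1 this).symm

lemma rho_F (hkd : d < k) {f : Fin k → ℝ} (hf : ∀ i : Fin k, (i : ℕ) < d → f i = 0) :
    𝒟.rho f = 0 := by
  apply 𝒟.E_zero hkd (𝒟.rho_mem f)
  intro i hi
  have := 𝒟.rho_decomp f i hi
  rw [hf i hi] at this
  linarith

/-- restriction to the first `d` coordinates -/
def base (hkd : d < k) (n : Fin k → ℤ) : Fin d → ℤ := fun i => n (Fin.castLE hkd.le i)

/-- The linear forms defining `E`. -/
def LL (b : Fin d → ℤ) (j : Fin k) : ℝ := 𝒟.rho (emb k d (intVec b)) j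

lemma LL_add (a b : Fin d → ℤ) (j : Fin k) : 𝒟.LL (a + b) j = 𝒟.LL a j + 𝒟.LL b j := by
  simp [LL, intVec_add, emb_add]

lemma LL_smul (c : ℤ) (b : Fin d → ℤ) (j : Fin k) : 𝒟.LL (c • b) j = c * 𝒟.LL b j := by
  have : intVec (c • b) = (c : ℝ) • intVec b := by funext i; simp [intVec]
  rw [LL, LL, this, emb_smul, map_smul]
  rfl

lemma LL_neg (b : Fin d → ℤ) (j : Fin k) : 𝒟.LL (-b) j = - 𝒟.LL b j := by
  have := 𝒟.LL_smul (-1) b j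
  simpa using this

lemma rho_intVec (hkd : d < k) (n : Fin k → ℤ) :
    𝒟.rho (intVec n) = 𝒟.rho (emb k d (intVec (base hkd n))) := by
  rw [← sub_eq_zero, ← map_sub]
  apply 𝒟.rho_F hkd
  intro i hi
  simp [emb, intVec, base, hi]

lemma rhoStar_intVec (hkd : d < k) (n : Fin k → ℤ) (j : Fin k) :
    𝒟.rhoStar (intVec n) j = n j - 𝒟.LL (base hkd n) j := by
  simp only [rhoStar, Pi.sub_apply, 𝒟.rho_intVec hkd, LL]
  rfl

lemma rhoStar_add (x y : Fin k → ℝ) : 𝒟.rhoStar (x + y) = 𝒟.rhoStar x + 𝒟.rhoStar y := by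
  simp only [rhoStar, map_add]; abel

lemma rhoStar_sub (x y : Fin k → ℝ) : 𝒟.rhoStar (x - y) = 𝒟.rhoStar x - 𝒟.rhoStar y := by
  simp only [rhoStar, map_sub]; abel

lemma mem_strip (hkd : d < k) (hc : 𝒟.IsCubical) (z : Fin k → ℝ) :
    z ∈ 𝒟.strip ↔ ∀ j : Fin k, d ≤ (j : ℕ) → 0 ≤ 𝒟.rhoStar z j ∧ 𝒟.rhoStar z j < 1 := by
  rw [IsCubical] at hc
  constructor
  · rintro ⟨w, hw, e, he, rfl⟩ j hj
    have hw0 : 𝒟.rho w = 0 := 𝒟.rho_F hkd (fun i hi => 𝒟.window_sub w hw i hi)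
    have : 𝒟.rhoStar (w + e) = w := by
      simp [rhoStar, hw0, 𝒟.rho_E hkd he]
    rw [this]
    rw [hc] at hw
    have := hw j
    rwa [if_neg (by omega)] at this
  · intro h
    refine ⟨𝒟.rhoStar z, ?_, 𝒟.rho z, 𝒟.rho_mem z, by simp [rhoStar]⟩
    rw [hc]
    intro i
    split_ifs with hi
    · exact 𝒟.rho_decomp z i hi
    · exact h i (by omega)

lemma intRep_eq (n : Fin k → ℤ) (hn : intVec n + 𝒟.s ∈ 𝒟.strip) :
    𝒟.intRep (𝒟.proj (intVec n + 𝒟.s)) = n := by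
  have h := Classical.epsilon_spec (p := fun m : Fin k → ℤ =>
    intVec m + 𝒟.s ∈ 𝒟.strip ∧ 𝒟.proj (intVec m + 𝒟.s) = 𝒟.proj (intVec n + 𝒟.s))
    ⟨n, hn, rfl⟩
  apply 𝒟.proj_inj
  have h2 := h.2
  have h3 := (𝒟.proj.map_add _ _).symm.trans (h2.trans (𝒟.proj.map_add _ _))
  exact add_right_cancel h3

lemma exists_strip (hkd : d < k) (hc : 𝒟.IsCubical) (b : Fin d → ℤ) :
    ∃ n : Fin k → ℤ, base hkd n = b ∧ intVec n + 𝒟.s ∈ 𝒟.strip := by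
  refine ⟨fun j => if h : (j : ℕ) < d then b ⟨j, h⟩ else
    -⌊- 𝒟.LL b j + 𝒟.rhoStar 𝒟.s j⌋, ?_⟩
  have hb : base hkd (fun j : Fin k => if h : (j : ℕ) < d then b ⟨j, h⟩ else
    -⌊- 𝒟.LL b j + 𝒟.rhoStar 𝒟.s j⌋) = b := by
    funext i; simp [base]
  refine ⟨hb, ?_⟩
  rw [𝒟.mem_strip hkd hc]
  intro j hj
  rw [rhoStar_add, Pi.add_apply, 𝒟.rhoStar_intVec hkd, hb]
  rw [dif_neg (by omega)]
  have h1 := Int.floor_le (- 𝒟.LL b j + 𝒟.rhoStar 𝒟.s j)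
  have h2 := Int.lt_floor_add_one (- 𝒟.LL b j + 𝒟.rhoStar 𝒟.s j)
  push_cast
  constructor <;> linarith

lemma dense_rhoStar (hkd : d < k) (t η : Fin k → ℝ) (hη : ∀ j, 0 < η j) :
    ∃ n : Fin k → ℤ, ∀ j : Fin k, d ≤ (j : ℕ) →
      |𝒟.rhoStar (intVec n + 𝒟.s) j - t j| < η j := by
  have hcont : Continuous 𝒟.rhoStar := by
    have : Continuous 𝒟.rho := LinearMap.continuous_of_finiteDimensional _
    unfold rhoStar
    fun_prop
  let v : Fin k → ℝ := fun j => if (j : ℕ) < d then 0 else t j - 𝒟.rhoStar 𝒟.s j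
  have hv : 𝒟.rhoStar v = v := by
    have : 𝒟.rho v = 0 := 𝒟.rho_F hkd (fun i hi => by simp [v, hi])
    simp [rhoStar, this]
  let U : Set (Fin k → ℝ) := {x | ∀ j, |𝒟.rhoStar x j - v j| < η j}
  have hU : IsOpen U := by
    have : U = ⋂ j, {x | |𝒟.rhoStar x j - v j| < η j} := by ext; simp [U]
    rw [this]
    apply isOpen_iInter_of_finite
    intro j
    apply isOpen_lt _ continuous_const
    have : Continuous fun x => 𝒟.rhoStar x j := (continuous_apply j).comp hcont
    fun_prop
  obtain ⟨x, ⟨e, he, n, rfl⟩, hx⟩ := 𝒟.totallyIrrational.exists_mem_open hU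
    ⟨v, by intro j; rw [hv]; simpa using hη j⟩
  refine ⟨n, fun j hj => ?_⟩
  have h1 := hx j
  have h2 : 𝒟.rhoStar e = 0 := by simp [rhoStar, 𝒟.rho_E hkd he]
  rw [rhoStar_add, h2, zero_add] at h1
  have h3 : v j = t j - 𝒟.rhoStar 𝒟.s j := by simp [v, show ¬ (j : ℕ) < d by omega]
  rw [h3] at h1
  rw [rhoStar_add, Pi.add_apply]
  convert h1 using 2
  ring

/-- Patterns force a position in the window. -/
lemma pattern_window (hkd : d < k) (hc : 𝒟.IsCubical) (Ω : Set (Fin d → ℝ))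
    (n₁ n : Fin k → ℤ) (h₁ : intVec n₁ + 𝒟.s ∈ 𝒟.strip) (hn : intVec n + 𝒟.s ∈ 𝒟.strip)
    (hP : 𝒟.PatchEquiv Ω (𝒟.proj (intVec n + 𝒟.s)) (𝒟.proj (intVec n₁ + 𝒟.s)))
    (j : Fin k) (hj : d ≤ (j : ℕ)) (q : Fin d → ℤ) (hq : intVec q ∈ Ω) (p : ℤ) (θ : ℝ)
    (hθ1 : θ ≤ 1)
    (hp : (p : ℝ) - 𝒟.LL q j = θ) (hw : 1 - θ < 𝒟.rhoStar (intVec n₁ + 𝒟.s) j) :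
    1 - θ ≤ 𝒟.rhoStar (intVec n + 𝒟.s) j := by
  obtain ⟨n₂, hb, h₂⟩ := 𝒟.exists_strip hkd hc (base hkd n₁ + q)
  have hmem : 𝒟.proj (intVec n₂ + 𝒟.s) ∈ 𝒟.patch Ω (𝒟.proj (intVec n₁ + 𝒟.s)) := by
    refine ⟨⟨_, ⟨h₂, n₂, rfl⟩, rfl⟩, ?_⟩
    rw [𝒟.intRep_eq _ h₁, 𝒟.intRep_eq _ h₂, ← intVec_sub, 𝒟.rho_intVec hkd]
    refine ⟨_, ⟨_, hq, rfl⟩, ?_⟩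
    congr 3
    have : base hkd (n₂ - n₁) = base hkd n₂ - base hkd n₁ := rfl
    rw [this, hb]; abel
  have hmem' : 𝒟.proj (intVec n₂ + 𝒟.s) + (𝒟.proj (intVec n + 𝒟.s) - 𝒟.proj (intVec n₁ + 𝒟.s))
      ∈ 𝒟.patch Ω (𝒟.proj (intVec n + 𝒟.s)) := by
    rw [hP]; exact ⟨_, hmem, rfl⟩
  obtain ⟨⟨_, ⟨h₃, n₃, rfl⟩, heq⟩, -⟩ := hmem'
  have h3 : n₃ = n₂ + n - n₁ := by
    apply 𝒟.proj_inj
    rw [intVec_sub, intVec_add]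
    simp only [map_add, map_sub] at heq ⊢
    have := congrArg (fun z => z - 𝒟.proj 𝒟.s) heq
    rw [add_sub_cancel_right] at this
    rw [this]; abel
  have e3 : 𝒟.rhoStar (intVec n₃ + 𝒟.s) j = 𝒟.rhoStar (intVec n₂ + 𝒟.s) j
      + 𝒟.rhoStar (intVec n + 𝒟.s) j - 𝒟.rhoStar (intVec n₁ + 𝒟.s) j := by
    rw [h3, intVec_sub, intVec_add]
    simp only [rhoStar_add, rhoStar_sub, Pi.add_apply, Pi.sub_apply]; ring
  have e2 : 𝒟.rhoStar (intVec n₂ + 𝒟.s) j - 𝒟.rhoStar (intVec n₁ + 𝒟.s) j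
      = θ + ((n₂ j - n₁ j - p : ℤ) : ℝ) := by
    simp only [rhoStar_add, Pi.add_apply, 𝒟.rhoStar_intVec hkd, hb, LL_add, ← hp]
    push_cast; ring
  have b1 := (𝒟.mem_strip hkd hc _).1 h₁ j hj
  have b2 := (𝒟.mem_strip hkd hc _).1 h₂ j hj
  have b3 := (𝒟.mem_strip hkd hc _).1 h₃ j hj
  have hlt : ((n₂ j - n₁ j - p : ℤ) : ℝ) < ((0 : ℤ) : ℝ) := by
    push_cast at e2 ⊢; linarith
  have hle : (n₂ j - n₁ j - p : ℤ) ≤ -1 := by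
    have := Int.cast_lt.1 hlt; omega
  have hle' : ((n₂ j - n₁ j - p : ℤ) : ℝ) ≤ -1 := by exact_mod_cast hle
  linarith

lemma proj_bound (hc : 𝒟.IsCubical) : ∃ K : ℝ, 0 ≤ K ∧
    ∀ n : Fin k → ℤ, intVec n + 𝒟.s ∈ 𝒟.strip → ∀ i : Fin k, (i : ℕ) < d →
      |𝒟.proj (intVec n + 𝒟.s) i - (intVec n + 𝒟.s) i| ≤ K := by
  let T := LinearMap.toContinuousLinearMap 𝒟.proj
  refine ⟨‖T‖, norm_nonneg _, ?_⟩
  rintro n ⟨w, hw, e, he, hwe⟩ i hi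
  rw [hwe, map_add, 𝒟.proj_id e he]
  have hw0 := 𝒟.window_sub w hw i hi
  have hn : ‖w‖ ≤ 1 := by
    rw [IsCubical] at hc
    rw [hc] at hw
    rw [pi_norm_le_iff_of_nonneg zero_le_one]
    intro l
    have := hw l
    split_ifs at this with hl
    · simp [this]
    · rw [Real.norm_eq_abs, abs_le]; constructor <;> linarith
  have h1 : ‖T w‖ ≤ ‖T‖ := by
    calc ‖T w‖ ≤ ‖T‖ * ‖w‖ := T.le_opNorm w
      _ ≤ ‖T‖ * 1 := by gcongr
      _ = _ := mul_one _
  have h2 : ‖T w i‖ ≤ ‖T w‖ := norm_le_pi_norm _ i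
  have h3 : T w = 𝒟.proj w := rfl
  rw [h3, Real.norm_eq_abs] at h2
  simp only [Pi.add_apply, hw0]
  rw [show 𝒟.proj w i + e i - (0 + e i) = 𝒟.proj w i by ring]
  rw [h3] at h1
  linarith

/-- Main covering consequence of linear repetitivity. -/
lemma main_cover (hd : 1 ≤ d) (hkd : d < k) (hc : 𝒟.IsCubical) (hLR : 𝒟.IsLR (RdCollection d)) :
    ∃ A : ℝ, 0 < A ∧ ∀ (N : Fin d → ℕ) (P : ℝ), (∀ i, 1 ≤ N i) → 1 ≤ P →
      P ^ d = ∏ i, (N i : ℝ) →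
      ∃ M : ℕ, (2 * M + 1 : ℝ) ≤ A * P ∧
      ∀ (J : Finset (Fin k)) (q : Fin k → Fin d → ℤ) (p : Fin k → ℤ) (θ : Fin k → ℝ),
        (∀ j ∈ J, d ≤ (j : ℕ)) → (∀ j ∈ J, ∀ i, |q j i| ≤ N i) →
        (∀ j, 0 < θ j) → (∀ j, θ j ≤ 1) → (∀ j ∈ J, (p j : ℝ) - 𝒟.LL (q j) j = θ j) →
        ∀ t : Fin k → ℝ, ∃ (b : Fin d → ℤ) (z : Fin k → ℤ), (∀ i, |b i| ≤ M) ∧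
          ∀ j ∈ J, 1 - 2 * θ j ≤ t j - 𝒟.LL b j + z j ∧ t j - 𝒟.LL b j + z j ≤ 1 + θ j := by
  obtain ⟨C, hC, hLR⟩ := hLR
  obtain ⟨K, hK, hproj⟩ := 𝒟.proj_bound hc
  obtain ⟨c, hc0, hcd⟩ : ∃ c : ℝ, 0 ≤ c ∧ c ^ d = C :=
    ⟨C ^ (1 / (d : ℝ)), by positivity, by
      rw [← Real.rpow_natCast, ← Real.rpow_mul hC.le, one_div, inv_mul_cancel₀, Real.rpow_one]
      exact_mod_cast (by omega : d ≠ 0)⟩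
  refine ⟨2 * c + 2 * K + 3, by positivity, ?_⟩
  intro N P hN hP hPN
  refine ⟨⌈c * P + K⌉₊, ?_, ?_⟩
  · have := (Nat.ceil_lt_add_one (show 0 ≤ c * P + K by positivity)).le
    nlinarith
  intro J q p θ hJ hq hθ hθ1 hp t
  set Ω : Set (Fin d → ℝ) := {x | ∀ i, ((-(N i : ℤ) : ℤ) : ℝ) ≤ x i ∧ x i ≤ ((N i : ℤ) : ℝ)} with hΩ
  have hΩR : Ω ∈ RdCollection d := ⟨fun i => -(N i : ℤ), fun i => N i, fun i => by
    have := hN i; simp only; omega, rfl⟩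
  have hvolΩ : volume Ω = ENNReal.ofReal ((2 * P) ^ d) := by
    have : Ω = Icc (fun i => ((-(N i : ℤ) : ℤ) : ℝ)) (fun i => ((N i : ℤ) : ℝ)) := by
      ext x; simp [hΩ, Pi.le_def, forall_and]
    rw [this, Real.volume_Icc_pi, ← ENNReal.ofReal_prod_of_nonneg]
    · congr 1
      rw [mul_pow, hPN, ← Fin.prod_const, ← Finset.prod_mul_distrib]
      apply Finset.prod_congr rfl
      intro i _; push_cast; ring
    · intro i _; push_cast; linarith [Nat.cast_nonneg (α := ℝ) (N i)]
  -- a point with the desired pattern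
  obtain ⟨n₁, hn₁⟩ := 𝒟.dense_rhoStar hkd (fun j => 1 - θ j / 2) (fun j => θ j / 2)
    (fun j => by have := hθ j; positivity)
  have hs₁ : intVec n₁ + 𝒟.s ∈ 𝒟.strip := by
    rw [𝒟.mem_strip hkd hc]
    intro j hj
    have := abs_lt.1 (hn₁ j hj)
    have := hθ1 j
    constructor <;> linarith
  -- an approximating point
  obtain ⟨n₀, hn₀⟩ := 𝒟.dense_rhoStar hkd t θ hθ
  obtain ⟨y', ⟨⟨_, ⟨hs, n, rfl⟩, rfl⟩, _, ⟨u, hu, rfl⟩, huy⟩, hPE⟩ := hLR Ω hΩR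
    (𝒟.proj (intVec n₁ + 𝒟.s)) ⟨_, ⟨hs₁, n₁, rfl⟩, rfl⟩
    (fun i => (intVec n₀ + 𝒟.s) (Fin.castLE hkd.le i)) (c * P) (by
      rw [Real.volume_pi_closedBall _ (by positivity), hvolΩ, ← ENNReal.ofReal_mul hC.le, ← hcd]
      congr 1
      simp only [Fintype.card_fin]
      rw [← mul_pow]; ring)
  refine ⟨base hkd (n - n₀), n - n₀, ?_, ?_⟩
  · intro i
    have h1 := hproj n hs (Fin.castLE hkd.le i) (by simp)
    have h2 : 𝒟.proj (intVec n + 𝒟.s) (Fin.castLE hkd.le i) = u i := by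
      rw [← huy]
      have := 𝒟.rho_decomp (emb k d u) (Fin.castLE hkd.le i) (by simp)
      have h2 : emb k d u (Fin.castLE hkd.le i) = u i := by simp [emb]
      linarith
    rw [h2] at h1
    have h3 : |u i - (intVec n₀ + 𝒟.s) (Fin.castLE hkd.le i)| ≤ c * P := by
      have := dist_le_pi_dist u (fun i => (intVec n₀ + 𝒟.s) (Fin.castLE hkd.le i)) i
      rw [Real.dist_eq] at this
      exact this.trans hu
    have h4 : |((base hkd (n - n₀) i : ℤ) : ℝ)| ≤ c * P + K := by
      rw [abs_le] at *
      simp only [base, Pi.sub_apply, Pi.add_apply, intVec] at *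
      push_cast
      constructor <;> linarith
    have h5 := h4.trans (Nat.le_ceil _)
    exact_mod_cast h5
  · intro j hj
    have hjd := hJ j hj
    have w1 := 𝒟.pattern_window hkd hc Ω n₁ n hs₁ hs hPE j hjd (q j) (by
      intro i
      have := abs_le.1 (hq j hj i)
      simp only [intVec]
      exact ⟨by exact_mod_cast this.1, by exact_mod_cast this.2⟩) (p j) (θ j) (hθ1 j) (hp j hj)
      (by have := abs_lt.1 (hn₁ j hjd); linarith)
    have w2 := ((𝒟.mem_strip hkd hc _).1 hs j hjd).2
    have w3 := abs_lt.1 (hn₀ j hjd)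
    have w4 : 𝒟.rhoStar (intVec n + 𝒟.s) j = 𝒟.rhoStar (intVec n₀ + 𝒟.s) j
       - 𝒟.LL (base hkd (n - n₀)) j + ((n - n₀) j : ℤ) := by
      have := 𝒟.rhoStar_intVec hkd (n - n₀) j
      rw [intVec_sub, rhoStar_sub, Pi.sub_apply] at this
      simp only [rhoStar_add, Pi.add_apply]
      linarith
    constructor <;> linarith

end CPS
lemma cover_measure {ι β : Type*} [Fintype ι] [DecidableEq ι] (B : Finset β) (f : β → ι → ℝ)
    (θ : ι → ℝ) (hθ : ∀ j, 0 < θ j) (hθ1 : ∀ j, θ j ≤ 1)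
    (h : ∀ t : ι → ℝ, ∃ b ∈ B, ∃ z : ι → ℤ, ∀ j,
      1 - 2 * θ j ≤ t j - f b j + z j ∧ t j - f b j + z j ≤ 1 + θ j) :
    1 ≤ (B.card : ℝ) * ∏ j, (15 * θ j) := by
  classical
  let Z : Finset (ι → ℤ) := Fintype.piFinset (fun _ => Finset.Icc (-2 : ℤ) 2)
  let lo : β × (ι → ℤ) → ι → ℝ := fun x j => 1 - 2 * θ j + Int.fract (f x.1 j) - x.2 j
  let hi : β × (ι → ℤ) → ι → ℝ := fun x j => 1 + θ j + Int.fract (f x.1 j) - x.2 j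
  have hcov : Icc (fun _ : ι => (0 : ℝ)) (fun _ => 1) ⊆ ⋃ x ∈ B ×ˢ Z, Icc (lo x) (hi x) := by
    intro t ht
    obtain ⟨b, hb, z, hz⟩ := h t
    simp only [mem_iUnion]
    refine ⟨(b, fun j => z j - ⌊f b j⌋), ?_, ?_⟩
    · rw [Finset.mem_product]
      refine ⟨hb, ?_⟩
      rw [Fintype.mem_piFinset]
      intro j
      have h0 : 0 ≤ t j := ht.1 j
      have h1 : t j ≤ 1 := ht.2 j
      have h2 := Int.fract_nonneg (f b j)
      have h3 := Int.fract_lt_one (f b j)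
      have h4 : f b j = ⌊f b j⌋ + Int.fract (f b j) := (Int.floor_add_fract _).symm
      have h5 := hz j
      have h6 := hθ1 j
      have h7 : (-3 : ℝ) < ((z j - ⌊f b j⌋ : ℤ) : ℝ) := by push_cast; linarith
      have h8 : ((z j - ⌊f b j⌋ : ℤ) : ℝ) < 3 := by push_cast; linarith
      have h7' : (-3 : ℤ) < z j - ⌊f b j⌋ := by exact_mod_cast h7
      have h8' : z j - ⌊f b j⌋ < 3 := by exact_mod_cast h8
      simp only [Finset.mem_Icc]
      omega
    · constructor
      · intro j
        have h4 : f b j = ⌊f b j⌋ + Int.fract (f b j) := (Int.floor_add_fract _).symm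
        have h5 := hz j
        simp only [lo]; push_cast; linarith
      · intro j
        have h4 : f b j = ⌊f b j⌋ + Int.fract (f b j) := (Int.floor_add_fract _).symm
        have h5 := hz j
        simp only [hi]; push_cast; linarith
  have hv : ∀ x, volume (Icc (lo x) (hi x)) = ENNReal.ofReal (∏ j, (3 * θ j)) := by
    intro x
    rw [Real.volume_Icc_pi, ← ENNReal.ofReal_prod_of_nonneg]
    · congr 1
      apply Finset.prod_congr rfl
      intro j _; simp only [lo, hi]; ring
    · intro j _; simp only [lo, hi]; linarith [hθ j]
  have h1 := (measure_mono (μ := volume) hcov).trans (measure_biUnion_finset_le _ _)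
  rw [Real.volume_Icc_pi] at h1
  simp only [hv, sub_zero, ENNReal.ofReal_one, Finset.prod_const_one, Finset.sum_const,
    nsmul_eq_mul] at h1
  have hpos : 0 ≤ ∏ j, (3 * θ j) := Finset.prod_nonneg fun j _ => by linarith [hθ j]
  rw [← ENNReal.ofReal_natCast, ← ENNReal.ofReal_mul (by positivity), ENNReal.one_le_ofReal] at h1
  rw [Finset.card_product, Fintype.card_piFinset] at h1
  convert h1 using 1
  push_cast
  rw [mul_assoc]
  congr 1
  rw [show (Finset.Icc (-2 : ℤ) 2).card = 5 from rfl, ← Finset.prod_mul_distrib]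
  apply Finset.prod_congr rfl
  intro j _
  norm_num
  ring

lemma distInt_pos {x : ℝ} (hx : ∀ z : ℤ, x ≠ z) : 0 < distInt x :=
  abs_pos.2 (sub_ne_zero.2 (hx _))

lemma distInt_le (x : ℝ) (z : ℤ) : distInt x ≤ |x - z| := round_le x z

lemma distInt_le_half (x : ℝ) : distInt x ≤ 1 / 2 := abs_sub_round x

namespace CPS

variable {k d : ℕ} (𝒟 : CPS k d)

lemma exists_theta (q : Fin d → ℤ) (j : Fin k) : ∃ (q' : Fin d → ℤ) (p : ℤ),
    (∀ i, |q' i| = |q i|) ∧ (p : ℝ) - 𝒟.LL q' j = distInt (𝒟.LL q j) := by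
  rcases le_total 0 (𝒟.LL q j - round (𝒟.LL q j)) with h | h
  · refine ⟨-q, - round (𝒟.LL q j), fun i => by simp, ?_⟩
    rw [LL_neg, distInt, abs_of_nonneg h]; push_cast; ring
  · refine ⟨q, round (𝒟.LL q j), fun i => rfl, ?_⟩
    rw [distInt, abs_of_nonpos h]; ring

/-- Combined estimate. -/
lemma main_bound (hd : 1 ≤ d) (hkd : d < k) (hc : 𝒟.IsCubical) (hLR : 𝒟.IsLR (RdCollection d)) :
    ∃ A : ℝ, 0 < A ∧ ∀ (N : Fin d → ℕ) (P : ℝ), (∀ i, 1 ≤ N i) → 1 ≤ P →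
      P ^ d = ∏ i, (N i : ℝ) →
      ∃ M : ℕ, (2 * M + 1 : ℝ) ≤ A * P ∧
      ∀ (J : Finset (Fin k)) (q : Fin k → Fin d → ℤ),
        (∀ j ∈ J, d ≤ (j : ℕ)) → (∀ j ∈ J, ∀ i, |q j i| ≤ N i) →
        (∀ j ∈ J, ∀ z : ℤ, 𝒟.LL (q j) j ≠ z) →
        ∀ B : Finset (Fin d → ℤ), (∀ b : Fin d → ℤ, (∀ i, |b i| ≤ M) →
          ∃ b' ∈ B, ∀ j ∈ J, ∃ z : ℤ, 𝒟.LL b j = 𝒟.LL b' j + z) →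
        1 ≤ (B.card : ℝ) * ∏ j ∈ J, (15 * distInt (𝒟.LL (q j) j)) := by
  classical
  obtain ⟨A, hA, H⟩ := 𝒟.main_cover hd hkd hc hLR
  refine ⟨A, hA, fun N P hN hP hPN => ?_⟩
  obtain ⟨M, hM, H⟩ := H N P hN hP hPN
  refine ⟨M, hM, fun J q hJ hq hz B hB => ?_⟩
  choose q' p hq' hp using fun j => 𝒟.exists_theta (q j) j
  let θ : Fin k → ℝ := fun j => if j ∈ J then distInt (𝒟.LL (q j) j) else 1
  have hθ : ∀ j, 0 < θ j := by
    intro j; simp only [θ]; split_ifs with h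
    · exact distInt_pos (hz j h)
    · exact one_pos
  have hθ1 : ∀ j, θ j ≤ 1 := by
    intro j; simp only [θ]; split_ifs with h
    · exact (distInt_le_half _).trans (by norm_num)
    · exact le_rfl
  have H := H J q' p θ hJ (fun j hj i => by rw [hq']; exact hq j hj i) hθ hθ1
    (fun j hj => by rw [hp]; simp [θ, hj])
  have key := cover_measure (ι := J) B (fun b j => 𝒟.LL b j) (fun j => θ j) (fun j => hθ j)
    (fun j => hθ1 j) (fun t => by
      obtain ⟨b, z, hb, hbz⟩ := H (fun j => if h : j ∈ J then t ⟨j, h⟩ else 0)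
      obtain ⟨b', hb', hl⟩ := hB b hb
      choose! w hw using hl
      refine ⟨b', hb', fun j => z j - w j, ?_⟩
      rintro ⟨j, hj⟩
      have h1 := hbz j hj
      rw [dif_pos hj, hw j hj] at h1
      push_cast
      constructor <;> linarith)
  rw [Finset.prod_coe_sort J (fun j => 15 * θ j)] at key
  convert key using 2
  apply Finset.prod_congr rfl
  intro j hj
  simp [θ, hj]

lemma LL_single (i : Fin d) (c : ℤ) (j : Fin k) :
    𝒟.LL (Pi.single i c) j = c * 𝒟.LL (Pi.single i 1) j := by
  rw [← LL_smul]
  congr 1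
  rw [← Pi.single_smul]; simp

lemma LL_sum (b : Fin d → ℤ) (j : Fin k) :
    𝒟.LL b j = ∑ i, b i * 𝒟.LL (Pi.single i 1) j := by
  have h : ∀ s : Finset (Fin d), 𝒟.LL (∑ i ∈ s, Pi.single i (b i)) j
      = ∑ i ∈ s, b i * 𝒟.LL (Pi.single i 1) j := by
    intro s
    induction s using Finset.induction_on with
    | empty => 
      have := 𝒟.LL_smul 0 0 j
      simpa using this
    | insert a s ha ih => rw [Finset.sum_insert ha, Finset.sum_insert ha, LL_add, ih, LL_single]
  rw [← h, Finset.univ_sum_single]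

/-- Some coordinate is irrational. -/
lemma exists_irr (hkd : d < k) (j : Fin k) (hj : d ≤ (j : ℕ)) :
    ∃ i : Fin d, ∀ c : ℕ, 0 < c → ∀ z : ℤ, (c : ℝ) * 𝒟.LL (Pi.single i 1) j ≠ z := by
  by_contra! hcon
  choose D hD z hz using hcon
  have hpos : 0 < ∏ i, D i := Finset.prod_pos fun i _ => hD i
  have hint : ∀ b : Fin d → ℤ, ∃ w : ℤ, ((∏ i, D i : ℕ) : ℝ) * 𝒟.LL b j = w := by
    intro b
    refine ⟨∑ i, b i * (((∏ l ∈ Finset.univ.erase i, D l : ℕ) : ℤ) * z i), ?_⟩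
    rw [LL_sum, Finset.mul_sum]
    push_cast
    apply Finset.sum_congr rfl
    intro i _
    rw [← hz, ← Finset.mul_prod_erase Finset.univ (fun l => (D l : ℝ)) (Finset.mem_univ i)]
    ring
  set Q : ℕ := ∏ i, D i
  have hQ : (0 : ℝ) < Q := by exact_mod_cast hpos
  -- `Q * rhoStar (n)` is an integer for each `n`
  obtain ⟨n, hn⟩ := 𝒟.dense_rhoStar hkd (fun j => 𝒟.rhoStar 𝒟.s j + 1 / (2 * Q))
    (fun _ => 1 / (2 * Q)) (fun _ => by positivity)
  have h1 := hn j hj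
  rw [rhoStar_add, Pi.add_apply, 𝒟.rhoStar_intVec hkd] at h1
  obtain ⟨w, hw⟩ := hint (base hkd n)
  have h2 : |(Q : ℝ) * (n j - 𝒟.LL (base hkd n) j) - 1 / 2| < 1 / 2 := by
    have : (Q : ℝ) * (n j - 𝒟.LL (base hkd n) j) - 1 / 2 = Q * ((n j : ℝ) - 𝒟.LL (base hkd n) j
      + 𝒟.rhoStar 𝒟.s j - (𝒟.rhoStar 𝒟.s j + 1 / (2 * Q))) := by
      field_simp; ring
    rw [this, abs_mul, abs_of_pos hQ]
    calc (Q : ℝ) * _ < Q * (1 / (2 * Q)) := by gcongr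
      _ = 1 / 2 := by field_simp
  rw [mul_sub, hw, abs_lt] at h2
  have h3 : (0 : ℝ) < ((Q * n j - w : ℤ) : ℝ) := by push_cast; linarith
  have h4 : ((Q * n j - w : ℤ) : ℝ) < 1 := by push_cast; linarith
  have h3' : (0 : ℤ) < Q * n j - w := by exact_mod_cast h3
  have h4' : (Q * n j - w : ℤ) < 1 := by exact_mod_cast h4
  omega

lemma dirichlet (N : ℕ) (hN : 0 < N) (x : ℝ) :
    ∃ q : ℕ, 0 < q ∧ q ≤ N ∧ distInt (q * x) ≤ 1 / (N + 1) :=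
  Real.exists_nat_abs_mul_sub_round_le x hN

/-- the side lengths: `N` at `i`, `1` elsewhere -/
lemma prod_side (i : Fin d) (N : ℕ) :
    ∏ l, ((Function.update (fun _ : Fin d => 1) i N l : ℕ) : ℝ) = N := by
  rw [← Nat.cast_prod, Finset.prod_update_of_mem (Finset.mem_univ i)]
  simp

lemma single_le (i : Fin d) (N q : ℕ) (hq : q ≤ N) (l : Fin d) :
    |(Pi.single i (q : ℤ) : Fin d → ℤ) l| ≤ ((Function.update (fun _ : Fin d => 1) i N l : ℕ) : ℤ) := by
  by_cases h : l = i
  · subst h; simpa using hq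
  · simp [h]

lemma case_one (hd : 1 ≤ d) (hkd : d < k) (hc : 𝒟.IsCubical) (hLR : 𝒟.IsLR (RdCollection d))
    (j : Fin k) (hj : d ≤ (j : ℕ)) (q₀ : Fin d → ℤ) (hq₀ : q₀ ≠ 0) (z₀ : ℤ)
    (hz₀ : 𝒟.LL q₀ j = z₀) : False := by
  classical
  obtain ⟨A, hA, H⟩ := 𝒟.main_bound hd hkd hc hLR
  obtain ⟨i, hi⟩ := 𝒟.exists_irr hkd j hj
  obtain ⟨i₀, hi₀⟩ : ∃ i₀, q₀ i₀ ≠ 0 := by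
    by_contra! h; exact hq₀ (funext h)
  let Q : ℕ := ∑ i, (q₀ i).natAbs
  have hQ : ∀ i, |q₀ i| ≤ Q := by
    intro i
    rw [Int.abs_eq_natAbs]
    exact_mod_cast Finset.single_le_sum (f := fun i => (q₀ i).natAbs) (fun _ _ => Nat.zero_le _)
      (Finset.mem_univ i)
  let Kc : ℝ := Q * ((1 + Q) * A) ^ (d - 1) * 15
  obtain ⟨n, hn⟩ := exists_nat_gt (max Kc 1)
  have hn1 : (1 : ℝ) < n := lt_of_le_of_lt (le_max_right _ _) hn
  have hnK : Kc < n := lt_of_le_of_lt (le_max_left _ _) hn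
  have hn0 : 0 < n := by
    have : (0 : ℝ) < n := by linarith
    exact_mod_cast this
  obtain ⟨M, hM, H⟩ := H (Function.update (fun _ => 1) i (n ^ d)) n
    (fun l => by
      by_cases h : l = i
      · subst h; simpa using Nat.one_le_pow _ _ hn0
      · simp [h]) hn1.le (by rw [prod_side]; push_cast; rfl)
  obtain ⟨q, hq0, hqN, hqd⟩ := dirichlet (n ^ d) (by positivity) (𝒟.LL (Pi.single i 1) j)
  let M' : ℕ := M * (1 + Q)
  let B : Finset (Fin d → ℤ) := Fintype.piFinset
    (Function.update (fun _ => Finset.Icc (-(M' : ℤ)) M') i₀ (Finset.Ico 0 |q₀ i₀|))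
  have hB : (B.card : ℝ) ≤ Q * ((1 + Q) * (A * n)) ^ (d - 1) := by
    have h1 : B.card = (|q₀ i₀|).toNat * (2 * M' + 1) ^ (d - 1) := by
      rw [Fintype.card_piFinset, ← Finset.mul_prod_erase _ _ (Finset.mem_univ i₀)]
      congr 1
      · simp
      · rw [Finset.prod_congr rfl (g := fun _ => 2 * M' + 1), Finset.prod_const]
        · simp
        · intro l hl
          rw [Function.update_of_ne (Finset.ne_of_mem_erase hl), Int.card_Icc]
          omega
    have h2 : (|q₀ i₀|).toNat ≤ Q := by have := hQ i₀; omega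
    rw [h1]
    push_cast
    have h3 : ((|q₀ i₀|).toNat : ℝ) ≤ Q := by exact_mod_cast h2
    have h4 : (2 * (M' : ℝ) + 1) ≤ (1 + Q) * (A * n) := by
      calc (2 * (M' : ℝ) + 1) ≤ (1 + Q) * (2 * M + 1) := by
            simp only [M']; push_cast
            nlinarith [Nat.cast_nonneg (α := ℝ) Q, Nat.cast_nonneg (α := ℝ) M]
        _ ≤ _ := by gcongr
    gcongr
  have key := H {j} (fun _ => Pi.single i (q : ℤ)) (by simpa using hj)
    (fun _ _ l => single_le i _ q hqN l)
    (fun j' hj' z => by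
      rw [Finset.mem_singleton] at hj'
      subst hj'
      rw [LL_single]; exact_mod_cast hi q hq0 z) B
    (fun b hb => by
      refine ⟨b - (b i₀ / q₀ i₀) • q₀, ?_, ?_⟩
      · rw [Fintype.mem_piFinset]
        intro l
        by_cases h : l = i₀
        · subst h
          rw [Function.update_self, Finset.mem_Ico]
          simp only [Pi.sub_apply, Pi.smul_apply, smul_eq_mul]
          have := Int.mul_ediv_add_emod (b l) (q₀ l)
          have h1 := Int.emod_nonneg (b l) hi₀
          have h2 := Int.emod_lt_abs (b l) hi₀
          constructor <;> linarith [mul_comm (q₀ l) (b l / q₀ l)]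
        · rw [Function.update_of_ne h, Finset.mem_Icc, ← abs_le]
          simp only [Pi.sub_apply, Pi.smul_apply, smul_eq_mul]
          have h1 : |b i₀ / q₀ i₀| ≤ M := by
            refine le_trans ?_ (hb i₀)
            rw [Int.abs_eq_natAbs, Int.abs_eq_natAbs]
            exact_mod_cast Int.natAbs_ediv_le_natAbs _ _
          calc |b l - b i₀ / q₀ i₀ * q₀ l| ≤ |b l| + |b i₀ / q₀ i₀ * q₀ l| := abs_sub _ _
            _ ≤ M + M * Q := by
              rw [abs_mul]
              have := hb l
              have := hQ l
              gcongr
            _ = M' := by simp only [M']; push_cast; ring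
      · intro j' hj'
        rw [Finset.mem_singleton] at hj'
        subst hj'
        refine ⟨(b i₀ / q₀ i₀) * z₀, ?_⟩
        have := 𝒟.LL_add (b - (b i₀ / q₀ i₀) • q₀) ((b i₀ / q₀ i₀) • q₀) j'
        rw [sub_add_cancel, LL_smul, hz₀] at this
        rw [this]; push_cast; ring)
  rw [Finset.prod_singleton, LL_single] at key
  have hqd' : distInt (((q : ℤ) : ℝ) * 𝒟.LL (Pi.single i 1) j) ≤ 1 / ((n : ℝ) ^ d + 1) := by
    push_cast at hqd ⊢; exact hqd
  have hfin : (1 : ℝ) ≤ Q * ((1 + Q) * (A * n)) ^ (d - 1) * (15 * (1 / ((n : ℝ) ^ d + 1))) := by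
    refine key.trans ?_
    gcongr
    exact mul_nonneg (by norm_num) (abs_nonneg _)
  have e1 : (Q : ℝ) * ((1 + Q) * (A * n)) ^ (d - 1) * (15 * (1 / ((n : ℝ) ^ d + 1)))
      = Kc * n ^ (d - 1) / ((n : ℝ) ^ d + 1) := by
    simp only [Kc]
    rw [show (1 + (Q : ℝ)) * (A * n) = ((1 + Q) * A) * n by ring, mul_pow _ (n : ℝ)]
    ring
  rw [e1, one_le_div (by positivity)] at hfin
  have e2 : (n : ℝ) ^ d = n * n ^ (d - 1) := by
    rw [← pow_succ']; congr 1; omega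
  rw [e2] at hfin
  have : Kc * (n : ℝ) ^ (d - 1) ≤ n * n ^ (d - 1) := by gcongr
  linarith

/-- the full box -/
lemma box_card (d M : ℕ) :
    (((Fintype.piFinset fun _ : Fin d => Finset.Icc (-(M : ℤ)) M).card : ℕ) : ℝ)
      = (2 * M + 1 : ℝ) ^ d := by
  rw [Fintype.card_piFinset]
  simp only [Int.card_Icc, Finset.prod_const, Finset.card_univ, Fintype.card_fin]
  rw [show ((M : ℤ) + 1 - -(M : ℤ)).toNat = 2 * M + 1 by omega]
  push_cast; rfl

lemma box_mem {M : ℕ} (J : Finset (Fin k)) (b : Fin d → ℤ) (hb : ∀ i, |b i| ≤ M) :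
    ∃ b' ∈ Fintype.piFinset fun _ : Fin d => Finset.Icc (-(M : ℤ)) M,
      ∀ j ∈ J, ∃ z : ℤ, 𝒟.LL b j = 𝒟.LL b' j + z :=
  ⟨b, by
    rw [Fintype.mem_piFinset]; intro i; rw [Finset.mem_Icc, ← abs_le]; exact hb i,
    fun j _ => ⟨0, by simp⟩⟩

lemma case_two (hd : 1 ≤ d) (hkd : d + 2 ≤ k) (hc : 𝒟.IsCubical)
    (hLR : 𝒟.IsLR (RdCollection d)) : False := by
  classical
  have hkd' : d < k := by omega
  obtain ⟨A, hA, H⟩ := 𝒟.main_bound hd hkd' hc hLR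
  have hinj := fun j hj q hq z hz => 𝒟.case_one hd hkd' hc hLR j hj q hq z hz
  let i : Fin d := ⟨0, by omega⟩
  let j₁ : Fin k := ⟨d, by omega⟩
  let j₂ : Fin k := ⟨d + 1, by omega⟩
  have hj12 : j₁ ≠ j₂ := by simp [j₁, j₂, Fin.ext_iff]
  obtain ⟨n, hn⟩ := exists_nat_gt (max (A ^ d * 225) 1)
  have hn1 : (1 : ℝ) < n := lt_of_le_of_lt (le_max_right _ _) hn
  have hnK : A ^ d * 225 < n := lt_of_le_of_lt (le_max_left _ _) hn
  have hn0 : 0 < n := by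
    have : (0 : ℝ) < n := by linarith
    exact_mod_cast this
  obtain ⟨M, hM, H⟩ := H (Function.update (fun _ => 1) i (n ^ d)) n
    (fun l => by
      by_cases h : l = i
      · subst h; simpa using Nat.one_le_pow _ _ hn0
      · simp [h]) hn1.le (by rw [prod_side]; push_cast; rfl)
  choose q hq0 hqN hqd using
    fun j => dirichlet (n ^ d) (by positivity) (𝒟.LL (Pi.single i 1) j)
  have hJ : ∀ j ∈ ({j₁, j₂} : Finset (Fin k)), d ≤ (j : ℕ) := by
    intro j hj
    simp only [Finset.mem_insert, Finset.mem_singleton] at hj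
    rcases hj with rfl | rfl <;> simp [j₁, j₂]
  have key := H {j₁, j₂} (fun j => Pi.single i (q j : ℤ)) hJ
    (fun j _ l => single_le i _ (q j) (hqN j) l)
    (fun j hj z hz => hinj j (hJ j hj) _ (by
      have := hq0 j
      simp only [ne_eq, Pi.single_eq_zero_iff]; omega) z hz) _ (𝒟.box_mem _)
  rw [box_card, Finset.prod_pair hj12, 𝒟.LL_single i (q j₁ : ℤ), 𝒟.LL_single i (q j₂ : ℤ)] at key
  have hqd' : ∀ j, distInt (((q j : ℤ) : ℝ) * 𝒟.LL (Pi.single i 1) j) ≤ 1 / ((n : ℝ) ^ d + 1) := by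
    intro j
    have := hqd j
    push_cast at this ⊢; exact this
  have h0 : ∀ x, 0 ≤ distInt x := fun x => abs_nonneg _
  have hfin : (1 : ℝ) ≤ (A * n) ^ d * ((15 * (1 / ((n : ℝ) ^ d + 1))) *
      (15 * (1 / ((n : ℝ) ^ d + 1)))) := by
    refine key.trans ?_
    have a1 := hqd' j₁
    have a2 := hqd' j₂
    have a3 := h0 (((q j₁ : ℤ) : ℝ) * 𝒟.LL (Pi.single i 1) j₁)
    have a4 := h0 (((q j₂ : ℤ) : ℝ) * 𝒟.LL (Pi.single i 1) j₂)
    gcongr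
  have e1 : (A * n) ^ d * ((15 * (1 / ((n : ℝ) ^ d + 1))) * (15 * (1 / ((n : ℝ) ^ d + 1))))
      = (A ^ d * 225) * n ^ d / ((n : ℝ) ^ d + 1) ^ 2 := by
    rw [mul_pow]; field_simp; ring
  rw [e1, one_le_div (by positivity)] at hfin
  have e2 : (n : ℝ) ≤ n ^ d := le_self_pow₀ hn1.le (by omega)
  have : (A ^ d * 225) * (n : ℝ) ^ d ≤ n ^ d * n ^ d := by gcongr; linarith
  nlinarith

end CPS
lemma littlewood_small (α β : ℝ) (hα : ∀ c : ℕ, 0 < c → ∀ z : ℤ, (c : ℝ) * α ≠ z)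
    (lw : Filter.liminf
        (fun n : ℕ => (n : ℝ) * distInt ((n : ℝ) * α) * distInt ((n : ℝ) * β))
        Filter.atTop = 0) (ε : ℝ) (hε : 0 < ε) :
    ∃ n : ℕ, 0 < n ∧ (n : ℝ) * distInt ((n : ℝ) * α) * distInt ((n : ℝ) * β) < ε := by
  have hfreq : ∃ᶠ n : ℕ in atTop,
      (n : ℝ) * distInt ((n : ℝ) * α) * distInt ((n : ℝ) * β) ≤ 1 := by
    rw [frequently_atTop]
    intro n₀
    obtain ⟨m, hm, hmin⟩ := Finset.exists_min_image (Finset.Icc 1 (n₀ + 1))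
      (fun n : ℕ => distInt ((n : ℝ) * α)) ⟨1, by simp⟩
    rw [Finset.mem_Icc] at hm
    have hpos : 0 < distInt ((m : ℝ) * α) := distInt_pos (hα m (by omega))
    obtain ⟨N, hN⟩ := exists_nat_one_div_lt hpos
    obtain ⟨q, hq0, hqN, hq⟩ := CPS.dirichlet (N + 1) (by omega) α
    refine ⟨q, ?_, ?_⟩
    · by_contra! hlt
      have h1 := hmin q (Finset.mem_Icc.2 ⟨hq0, by omega⟩)
      have h2 : (1 : ℝ) / (((N + 1 : ℕ) : ℝ) + 1) ≤ 1 / ((N : ℝ) + 1) := by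
        gcongr
        push_cast; linarith
      linarith
    · have h1 : (q : ℝ) * distInt ((q : ℝ) * α) ≤ 1 := by
        have hqN' : (q : ℝ) ≤ ((N + 1 : ℕ) : ℝ) := by exact_mod_cast hqN
        calc (q : ℝ) * distInt ((q : ℝ) * α)
            ≤ (((N + 1 : ℕ) : ℝ) + 1) * (1 / (((N + 1 : ℕ) : ℝ) + 1)) := by
              have : 0 ≤ distInt ((q : ℝ) * α) := abs_nonneg _
              gcongr; linarith
          _ = 1 := by field_simp
      have h2 : distInt ((q : ℝ) * β) ≤ 1 := (distInt_le_half _).trans (by norm_num)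
      exact mul_le_one₀ h1 (abs_nonneg _) h2
  have hcob : IsCoboundedUnder (· ≥ ·) atTop
      (fun n : ℕ => (n : ℝ) * distInt ((n : ℝ) * α) * distInt ((n : ℝ) * β)) :=
    IsCoboundedUnder.of_frequently_le hfreq
  have := frequently_lt_of_liminf_lt hcob (lw.trans_lt hε)
  rw [frequently_atTop] at this
  obtain ⟨n, hn, h⟩ := this 1
  exact ⟨n, hn, h⟩

lemma dual_aux (α β δ : ℝ) (hδ : 0 < δ) (n : ℕ) (hn : 0 < n)
    (hA : 0 < distInt (n * α)) (hB : 0 < distInt (n * β))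
    (hBA : distInt (n * β) ≤ distInt (n * α))
    (h : (n : ℝ) * distInt (n * α) * distInt (n * β) < δ ^ 2) :
    ∃ (X Y : ℕ) (a b : ℤ), 1 ≤ X ∧ 1 ≤ Y ∧ (a ≠ 0 ∨ b ≠ 0) ∧ |a| ≤ X ∧ |b| ≤ Y ∧
      (X : ℝ) * Y * distInt (a * α + b * β) ≤ 2 * δ := by
  set A := distInt (n * α) with hAdef
  set B := distInt (n * β) with hBdef
  have hn' : (0 : ℝ) < n := by exact_mod_cast hn
  have hn1 : (1 : ℝ) ≤ n := by exact_mod_cast hn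
  by_cases hc : n * B ≤ δ
  · refine ⟨1, n, 0, n, le_rfl, hn, Or.inr (by exact_mod_cast hn.ne'), by simp, by simp, ?_⟩
    have : ((0 : ℤ) : ℝ) * α + ((n : ℤ) : ℝ) * β = n * β := by push_cast; ring
    rw [this, ← hBdef]; push_cast; linarith
  push Not at hc
  have hAδ : A < δ := by
    by_contra! hh
    have : δ * δ ≤ n * B * A := by gcongr
    nlinarith
  set x := √(n * B / A)
  set y := √(n * A / B)
  have hxy : x * y = n := by
    rw [← Real.sqrt_mul (by positivity), show n * B / A * (n * A / B) = (n : ℝ) ^ 2 by field_simp,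
      Real.sqrt_sq hn'.le]
  have hxA : x * A ≤ δ := by
    have : x * A = √(n * A * B) := by
      rw [← Real.sqrt_sq hA.le, ← Real.sqrt_mul (by positivity), Real.sqrt_sq hA.le]
      congr 1; field_simp
    rw [this]; exact Real.sqrt_le_iff.2 ⟨hδ.le, h.le⟩
  have hyB : y * B ≤ δ := by
    have : y * B = √(n * A * B) := by
      rw [← Real.sqrt_sq hB.le, ← Real.sqrt_mul (by positivity), Real.sqrt_sq hB.le]
      congr 1; field_simp
    rw [this]; exact Real.sqrt_le_iff.2 ⟨hδ.le, h.le⟩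
  have hx1 : 1 ≤ x := by
    rw [Real.one_le_sqrt, one_le_div hA]; linarith
  have hy1 : 1 ≤ y := by
    rw [Real.one_le_sqrt, one_le_div hB]; nlinarith
  set X := ⌊x⌋₊
  set Y := ⌊y⌋₊
  have hX : (X : ℝ) ≤ x := Nat.floor_le (by linarith)
  have hY : (Y : ℝ) ≤ y := Nat.floor_le (by linarith)
  have hX' : x < X + 1 := Nat.lt_floor_add_one x
  have hY' : y < Y + 1 := Nat.lt_floor_add_one y
  set p₁ := round (n * α) with hp₁
  set p₂ := round (n * β) with hp₂
  have hcard : (Finset.Ico (0 : ℤ) n).card <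
      (Finset.range (X + 1) ×ˢ Finset.range (Y + 1)).card := by
    rw [Finset.card_product, Finset.card_range, Finset.card_range, Int.card_Ico]
    have : (n : ℝ) < (X + 1) * (Y + 1) := by rw [← hxy]; gcongr
    have : n < (X + 1) * (Y + 1) := by exact_mod_cast this
    simpa using this
  obtain ⟨⟨a₁, b₁⟩, h₁, ⟨a₂, b₂⟩, h₂, hne, heq⟩ :=
    Finset.exists_ne_map_eq_of_card_lt_of_maps_to hcard
      (f := fun u : ℕ × ℕ => ((u.1 : ℤ) * p₁ + u.2 * p₂) % (n : ℤ)) (by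
        intro u _
        simp only [Finset.coe_Ico, mem_Ico]
        have : (0 : ℤ) < n := by exact_mod_cast hn
        exact ⟨Int.emod_nonneg _ this.ne', Int.emod_lt_of_pos _ this⟩)
  simp only [Finset.mem_product, Finset.mem_range] at h₁ h₂
  obtain ⟨c, hc⟩ := (Int.ModEq.dvd heq.symm)
  refine ⟨X, Y, (a₁ : ℤ) - a₂, (b₁ : ℤ) - b₂, ?_, ?_, ?_, ?_, ?_, ?_⟩
  · exact Nat.le_floor (by simpa using hx1)
  · exact Nat.le_floor (by simpa using hy1)
  · by_contra! hh
    apply hne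
    ext
    · simp only; omega
    · simp only; omega
  · rw [abs_le]; omega
  · rw [abs_le]; omega
  have haX : |(((a₁ : ℤ) - a₂ : ℤ) : ℝ)| ≤ X := by
    have : |(a₁ : ℤ) - a₂| ≤ X := by rw [abs_le]; omega
    exact_mod_cast this
  have hbY : |(((b₁ : ℤ) - b₂ : ℤ) : ℝ)| ≤ Y := by
    have : |(b₁ : ℤ) - b₂| ≤ Y := by rw [abs_le]; omega
    exact_mod_cast this
  have hcR : (((a₁ : ℤ) - a₂ : ℤ) : ℝ) * p₁ + (((b₁ : ℤ) - b₂ : ℤ) : ℝ) * p₂ = n * c := by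
    have h3 : ((a₁ : ℤ) - a₂) * p₁ + ((b₁ : ℤ) - b₂) * p₂ = n * c := by
      rw [← hc]; ring
    exact_mod_cast h3
  set a : ℝ := (((a₁ : ℤ) - a₂ : ℤ) : ℝ)
  set b : ℝ := (((b₁ : ℤ) - b₂ : ℤ) : ℝ)
  have h4 : (n : ℝ) * (a * α + b * β - c) = a * (n * α - p₁) + b * (n * β - p₂) := by
    rw [mul_sub, ← hcR]; ring
  have h5 : (n : ℝ) * |a * α + b * β - c| ≤ 2 * δ := by
    rw [← abs_of_pos hn', ← abs_mul, h4]
    calc |a * (n * α - p₁) + b * (n * β - p₂)| ≤ |a * (n * α - p₁)| + |b * (n * β - p₂)| :=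
          abs_add_le _ _
      _ = |a| * A + |b| * B := by rw [abs_mul, abs_mul]; rfl
      _ ≤ x * A + y * B := by gcongr <;> linarith
      _ ≤ _ := by linarith
  calc (X : ℝ) * Y * distInt (a * α + b * β) ≤ x * y * |a * α + b * β - c| := by
        have := distInt_le (a * α + b * β) c
        have h0 : 0 ≤ distInt (a * α + b * β) := abs_nonneg _
        gcongr
    _ ≤ _ := by rw [hxy]; exact h5

lemma dual_littlewood (α β : ℝ) (hα : ∀ c : ℕ, 0 < c → ∀ z : ℤ, (c : ℝ) * α ≠ z)
    (hβ : ∀ c : ℕ, 0 < c → ∀ z : ℤ, (c : ℝ) * β ≠ z)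
    (lw : Filter.liminf
        (fun n : ℕ => (n : ℝ) * distInt ((n : ℝ) * α) * distInt ((n : ℝ) * β))
        Filter.atTop = 0) (δ : ℝ) (hδ : 0 < δ) :
    ∃ (X Y : ℕ) (a b : ℤ), 1 ≤ X ∧ 1 ≤ Y ∧ (a ≠ 0 ∨ b ≠ 0) ∧ |a| ≤ X ∧ |b| ≤ Y ∧
      (X : ℝ) * Y * distInt (a * α + b * β) ≤ 2 * δ := by
  obtain ⟨n, hn, h⟩ := littlewood_small α β hα lw (δ ^ 2) (by positivity)
  have hA := distInt_pos (hα n hn)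
  have hB := distInt_pos (hβ n hn)
  rcases le_total (distInt (n * β)) (distInt (n * α)) with hle | hle
  · exact dual_aux α β δ hδ n hn hA hB hle h
  · obtain ⟨X, Y, a, b, hX, hY, hab, ha, hb, hh⟩ := dual_aux β α δ hδ n hn hB hA hle
      (by rwa [mul_right_comm] at h)
    refine ⟨Y, X, b, a, hY, hX, hab.symm, hb, ha, ?_⟩
    rwa [mul_comm (Y : ℝ) X, add_comm]

namespace CPS

variable {k d : ℕ} (𝒟 : CPS k d)

lemma case_three (littlewood : ∀ α β : ℝ,
      Filter.liminf
        (fun n : ℕ => (n : ℝ) * distInt ((n : ℝ) * α) * distInt ((n : ℝ) * β))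
        Filter.atTop = 0)
    (hd : 2 ≤ d) (hkd : d + 1 = k) (hc : 𝒟.IsCubical)
    (hLR : 𝒟.IsLR (RdCollection d)) : False := by
  classical
  have hkd' : d < k := by omega
  obtain ⟨A, hA, H⟩ := 𝒟.main_bound (by omega) hkd' hc hLR
  let i₁ : Fin d := ⟨0, by omega⟩
  let i₂ : Fin d := ⟨1, by omega⟩
  have hi12 : i₁ ≠ i₂ := by simp [i₁, i₂, Fin.ext_iff]
  let j : Fin k := ⟨d, by omega⟩
  have hj : d ≤ (j : ℕ) := le_rfl
  have hinj := fun q hq z hz => 𝒟.case_one (by omega) hkd' hc hLR j hj q hq z hz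
  have hirr : ∀ i : Fin d, ∀ c : ℕ, 0 < c → ∀ z : ℤ, (c : ℝ) * 𝒟.LL (Pi.single i 1) j ≠ z := by
    intro i c hc z hz
    refine hinj (Pi.single i (c : ℤ)) ?_ z ?_
    · simp only [ne_eq, Pi.single_eq_zero_iff]; omega
    · rw [LL_single, ← hz]; push_cast; rfl
  obtain ⟨X, Y, a, b, hX, hY, hab, ha, hb, hXY⟩ := dual_littlewood _ _ (hirr i₁) (hirr i₂)
    (littlewood _ _) (1 / (60 * A ^ d)) (by positivity)
  have hN1 : ∀ i, 1 ≤ Function.update (Function.update (fun _ : Fin d => 1) i₁ X) i₂ Y i := by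
    intro i
    by_cases h2 : i = i₂
    · subst h2; simpa using hY
    · rw [Function.update_of_ne h2]
      by_cases h1 : i = i₁
      · subst h1; simpa using hX
      · rw [Function.update_of_ne h1]
  have hprod : ∏ i, ((Function.update (Function.update (fun _ : Fin d => 1) i₁ X) i₂ Y i : ℕ) : ℝ)
      = X * Y := by
    rw [← Nat.cast_prod, Finset.prod_update_of_mem (Finset.mem_univ i₂),
      Finset.prod_update_of_mem (by simp [hi12])]
    simp [mul_comm]
  have hXY1 : (1 : ℝ) ≤ X * Y := by
    have h1 : (1 : ℝ) ≤ X := by exact_mod_cast hX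
    have h2 : (1 : ℝ) ≤ Y := by exact_mod_cast hY
    nlinarith
  obtain ⟨P, hP1, hPd⟩ : ∃ P : ℝ, 1 ≤ P ∧ P ^ d = X * Y :=
    ⟨((X : ℝ) * Y) ^ (1 / (d : ℝ)), Real.one_le_rpow hXY1 (by positivity), by
      rw [← Real.rpow_natCast, ← Real.rpow_mul (by linarith), one_div, inv_mul_cancel₀,
        Real.rpow_one]
      exact_mod_cast (by omega : d ≠ 0)⟩
  obtain ⟨M, hM, H⟩ := H _ P hN1 hP1 (by rw [hprod, hPd])
  let q : Fin d → ℤ := Pi.single i₁ a + Pi.single i₂ b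
  have hq1 : q i₁ = a := by simp [q, hi12]
  have hq2 : q i₂ = b := by simp [q, hi12.symm]
  have hq0 : q ≠ 0 := by
    intro h0
    rw [h0] at hq1 hq2
    simp only [Pi.zero_apply] at hq1 hq2
    rcases hab with h | h
    · exact h hq1.symm
    · exact h hq2.symm
  have key := H {j} (fun _ => q) (by simpa using hj) (by
      intro _ _ i
      by_cases h2 : i = i₂
      · subst h2; rw [hq2]; simpa using hb
      · rw [Function.update_of_ne h2]
        by_cases h1 : i = i₁
        · subst h1; rw [hq1]; simpa using ha
        · rw [Function.update_of_ne h1]; simp [q, h1, h2])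
    (fun j' hj' z hz => by
      rw [Finset.mem_singleton] at hj'
      subst hj'
      exact hinj q hq0 z hz) _ (𝒟.box_mem _)
  have hLq : 𝒟.LL q j = a * 𝒟.LL (Pi.single i₁ 1) j + b * 𝒟.LL (Pi.single i₂ 1) j := by
    simp only [q]
    rw [LL_add, 𝒟.LL_single i₁ a, 𝒟.LL_single i₂ b]
  rw [box_card, Finset.prod_singleton, hLq] at key
  set D := distInt (a * 𝒟.LL (Pi.single i₁ 1) j + b * 𝒟.LL (Pi.single i₂ 1) j)
  have hD : 0 ≤ D := abs_nonneg _
  have : (1 : ℝ) ≤ 1 / 2 := by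
    calc (1 : ℝ) ≤ (2 * M + 1 : ℝ) ^ d * (15 * D) := key
      _ ≤ (A * P) ^ d * (15 * D) := by gcongr
      _ = 15 * A ^ d * (X * Y * D) := by rw [mul_pow, hPd]; ring
      _ ≤ 15 * A ^ d * (2 * (1 / (60 * A ^ d))) := by gcongr
      _ = 1 / 2 := by field_simp; norm_num
  norm_num at this

end CPS

/-- Assuming the Littlewood conjecture, for all integers `k > d ≥ 1` with
`(k,d) ≠ (2,1)`, there is no `k` to `d` cubical cut and project set which is LR with
respect to `ℛ_d`. -/
theorem littlewood_implies_no_cubical_LR_wrt_Rd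
    (littlewood : ∀ α β : ℝ,
      Filter.liminf
        (fun n : ℕ => (n : ℝ) * distInt ((n : ℝ) * α) * distInt ((n : ℝ) * β))
        Filter.atTop = 0)
    (k d : ℕ) (hd : 1 ≤ d) (hkd : d < k) (hne : ¬(k = 2 ∧ d = 1))
    (𝒟 : CPS k d) (h : 𝒟.IsCubicalCPSet) :
    ¬ 𝒟.IsLR (RdCollection d) := by
  intro hLR
  rcases Nat.lt_or_ge (d + 1) k with h2 | h2
  · exact 𝒟.case_two hd h2 h.1 hLR
  · exact 𝒟.case_three littlewood (by omega) (by omega) h.1 hLR
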